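/- Let n ≥ 2 and let K be the Cauchy–Szegő kernel on the quaternionic Heisenberg group 𝓗^{n−1}, and set K(g,h) = K(h^{−1}·g) for g ≠ h. Then there exist constants C > 0 and c > 0 (depending only on n) such that for all g, g₀, h ∈ 𝓗^{n−1} with h ≠ g, h ≠ g₀ and ρ(g₀,h) ≥ c·ρ(g,g₀), one has |K(g,h) − K(g₀,h)| ≤ C·ρ(g,g₀)/ρ(g₀,h)^{Q+1}, where Q = 4n+2. -/

import Mathlib

open Quaternion
noncomputable section

/-- An element of the quaternionic Heisenberg group `𝓗^m = Im ℍ × ℍ^m`,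
modelled as a pair `(t, y)` with `t : ℍ` (required to be purely imaginary via
the hypothesis `t.re = 0` in the theorems below) and `y : Fin m → ℍ`. -/
abbrev QH (m : ℕ) := ℍ[ℝ] × (Fin m → ℍ[ℝ])

/-- The group product `(t,y)·(t',y') = (t + t' + 2 Im⟨y,y'⟩, y + y')`, where
`⟨y,y'⟩ = Σ_l conj(y_l)·y'_l`. -/
def qmul {m : ℕ} (g h : QH m) : QH m :=
  (g.1 + h.1 + 2 * (∑ l, star (g.2 l) * h.2 l).im, g.2 + h.2)

/-- The group inverse `(t,y)⁻¹ = (−t,−y)`. -/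
def qinv {m : ℕ} (g : QH m) : QH m := (-g.1, -g.2)

/-- The homogeneous norm `‖(t,y)‖ = (|y|⁴ + |t|²)^{1/4}`. -/
def hnorm {m : ℕ} (g : QH m) : ℝ :=
  ((∑ l, ‖g.2 l‖ ^ 2) ^ 2 + ‖g.1‖ ^ 2) ^ ((1 : ℝ) / 4)

/-- The quasi-distance `ρ(h,g) = ‖g⁻¹·h‖`. -/
def qdist {m : ℕ} (h g : QH m) : ℝ := hnorm (qmul (qinv g) h)

/-- The dilation `δ_r(t,y) = (r²t, ry)`. -/
def qdil {m : ℕ} (r : ℝ) (g : QH m) : QH m := ((r ^ 2 : ℝ) • g.1, r • g.2)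

/-- The normalized Cauchy–Szegő kernel density: `s(σ)` is the `(2n−2)`-nd
derivative at `x = Re σ` of `x ↦ conj(x + Im σ)·(x² + |Im σ|²)^{−2}`
(i.e. `∂^{2(n−1)}/∂x₁^{2(n−1)}[conj σ/|σ|⁴]` with `c_{n−1} = 1`). -/
def sker (n : ℕ) (σ : ℍ[ℝ]) : ℍ[ℝ] :=
  iteratedDeriv (2 * n - 2)
    (fun x : ℝ => ((x ^ 2 + ‖σ.im‖ ^ 2) ^ 2)⁻¹ • star ((x : ℍ[ℝ]) + σ.im)) σ.re

/-- The Cauchy–Szegő kernel `K(t,y) = s(|y|² + t)` on `𝓗^m`. -/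
def Kker (n : ℕ) {m : ℕ} (g : QH m) : ℍ[ℝ] :=
  sker n (((∑ l, ‖g.2 l‖ ^ 2 : ℝ) : ℍ[ℝ]) + g.1)

open scoped ContDiff

/-- The quaternion `|y|² + t` at which the Cauchy–Szegő density is evaluated. -/
def qpoint {m : ℕ} (g : QH m) : ℍ[ℝ] := ((∑ l, ‖g.2 l‖ ^ 2 : ℝ) : ℍ[ℝ]) + g.1

theorem quaternion_re_sum {ι : Type*} (s : Finset ι) (f : ι → ℍ[ℝ]) :
    (∑ i ∈ s, f i).re = ∑ i ∈ s, (f i).re :=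
  map_sum (AddMonoidHom.mk' (fun q : ℍ[ℝ] => q.re) (by simp)) f s

theorem quaternion_im_sum {ι : Type*} (s : Finset ι) (f : ι → ℍ[ℝ]) :
    (∑ i ∈ s, f i).im = ∑ i ∈ s, (f i).im :=
  map_sum (AddMonoidHom.mk' (fun q : ℍ[ℝ] => q.im) (by simp)) f s

theorem quaternion_norm_sq (q : ℍ[ℝ]) : ‖q‖ ^ 2 = q.re ^ 2 + ‖q.im‖ ^ 2 := by
  simp only [sq ‖_‖, ← normSq_eq_norm_mul_self, normSq_def', re_im, imI_im, imJ_im, imK_im]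
  ring

theorem quaternion_norm_add_sq (a b : ℍ[ℝ]) :
    ‖a + b‖ ^ 2 = ‖a‖ ^ 2 + ‖b‖ ^ 2 + 2 * (star a * b).re := by
  simp only [sq ‖_‖, ← normSq_eq_norm_mul_self, normSq_add]
  simp

theorem qpoint_re {m : ℕ} {g : QH m} (hg : g.1.re = 0) :
    (qpoint g).re = ∑ l, ‖g.2 l‖ ^ 2 := by
  simp [qpoint, hg]

theorem qpoint_im {m : ℕ} {g : QH m} (hg : g.1.re = 0) : (qpoint g).im = g.1 := by
  ext <;> simp [qpoint, hg]

theorem hnorm_nonneg {m : ℕ} (g : QH m) : 0 ≤ hnorm g := by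
  unfold hnorm; positivity

theorem norm_qpoint {m : ℕ} {g : QH m} (hg : g.1.re = 0) : ‖qpoint g‖ = hnorm g ^ 2 := by
  have h : ‖qpoint g‖ ^ 2 = (∑ l, ‖g.2 l‖ ^ 2) ^ 2 + ‖g.1‖ ^ 2 := by
    rw [quaternion_norm_sq, qpoint_re hg, qpoint_im hg]
  unfold hnorm
  rw [← h, ← Real.rpow_natCast, ← Real.rpow_natCast, ← Real.rpow_mul (norm_nonneg _),
    ← Real.rpow_mul (norm_nonneg _)]
  norm_num

theorem sum_sq_le_hnorm_sq {m : ℕ} {g : QH m} (hg : g.1.re = 0) :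
    ∑ l, ‖g.2 l‖ ^ 2 ≤ hnorm g ^ 2 := by
  rw [← norm_qpoint hg, ← qpoint_re hg]
  refine abs_le_of_sq_le_sq' ?_ (norm_nonneg _) |>.2
  rw [quaternion_norm_sq]
  nlinarith [sq_nonneg ‖(qpoint g).im‖]

theorem qmul_re {m : ℕ} {g h : QH m} (hg : g.1.re = 0) (hh : h.1.re = 0) :
    (qmul g h).1.re = 0 := by
  simp [qmul, hg, hh, two_mul]

theorem qinv_re {m : ℕ} {g : QH m} (hg : g.1.re = 0) : (qinv g).1.re = 0 := by
  simp [qinv, hg]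

theorem qmul_qinv_cancel_middle {m : ℕ} (g g₀ h : QH m) :
    qmul (qmul (qinv h) g₀) (qmul (qinv g₀) g) = qmul (qinv h) g := by
  refine Prod.ext ?_ ?_
  · have key : (∑ l, star (-h.2 l) * g₀.2 l).im + (∑ l, star (-g₀.2 l) * g.2 l).im
        + (∑ l, star (-h.2 l + g₀.2 l) * (-g₀.2 l + g.2 l)).im
        = (∑ l, star (-h.2 l) * g.2 l).im := by
      rw [← im_add, ← im_add, ← Finset.sum_add_distrib, ← Finset.sum_add_distrib,
        quaternion_im_sum, quaternion_im_sum]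
      refine Finset.sum_congr rfl fun l _ => ?_
      have h1 : star (-h.2 l) * g₀.2 l + star (-g₀.2 l) * g.2 l
          + star (-h.2 l + g₀.2 l) * (-g₀.2 l + g.2 l)
          = star (-h.2 l) * g.2 l - star (g₀.2 l) * g₀.2 l := by
        simp only [star_add, star_neg]; noncomm_ring
      rw [h1, im_sub, Quaternion.star_mul_self, im_coe, sub_zero]
    simp only [qmul, qinv, Pi.add_apply, Pi.neg_apply]
    rw [← key]
    noncomm_ring
  · simp [qmul, qinv]

theorem qpoint_qmul {m : ℕ} (g h : QH m) :
    qpoint (qmul g h) = qpoint g + qpoint h + 2 * ∑ l, star (g.2 l) * h.2 l := by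
  set S := ∑ l, star (g.2 l) * h.2 l with hS
  have h1 : ∑ l, ‖g.2 l + h.2 l‖ ^ 2 = ∑ l, ‖g.2 l‖ ^ 2 + ∑ l, ‖h.2 l‖ ^ 2 + 2 * S.re := by
    rw [hS, quaternion_re_sum, Finset.mul_sum, ← Finset.sum_add_distrib,
      ← Finset.sum_add_distrib]
    exact Finset.sum_congr rfl fun l _ => quaternion_norm_add_sq _ _
  simp only [qpoint, qmul, Pi.add_apply, h1]
  rw [← hS]
  conv_rhs => rw [← Quaternion.re_add_im S]
  rw [two_mul S.re, two_mul, two_mul]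
  simp only [coe_add]
  abel

theorem norm_sum_star_mul_le {m : ℕ} {g h : QH m} (hg : g.1.re = 0) (hh : h.1.re = 0) :
    ‖∑ l, star (g.2 l) * h.2 l‖ ≤ hnorm g * hnorm h := by
  calc ‖∑ l, star (g.2 l) * h.2 l‖ ≤ ∑ l, ‖g.2 l‖ * ‖h.2 l‖ :=
        norm_sum_le_of_le _ fun l _ => by rw [norm_mul, Quaternion.norm_star]
    _ ≤ √(∑ l, ‖g.2 l‖ ^ 2) * √(∑ l, ‖h.2 l‖ ^ 2) := Real.sum_mul_le_sqrt_mul_sqrt _ _ _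
    _ ≤ hnorm g * hnorm h :=
        mul_le_mul (Real.sqrt_le_iff.2 ⟨hnorm_nonneg _, sum_sq_le_hnorm_sq hg⟩)
          (Real.sqrt_le_iff.2 ⟨hnorm_nonneg _, sum_sq_le_hnorm_sq hh⟩)
          (Real.sqrt_nonneg _) (hnorm_nonneg _)

theorem norm_qpoint_qmul_sub_le {m : ℕ} {g h : QH m} (hg : g.1.re = 0) (hh : h.1.re = 0) :
    ‖qpoint (qmul g h) - qpoint g‖ ≤ hnorm h ^ 2 + 2 * (hnorm g * hnorm h) := by
  have h1 : qpoint (qmul g h) - qpoint g = qpoint h + 2 * ∑ l, star (g.2 l) * h.2 l := by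
    rw [qpoint_qmul]; abel
  rw [h1, ← norm_qpoint hh, two_mul, two_mul]
  have hS := norm_sum_star_mul_le hg hh
  refine (norm_add_le _ _).trans ?_
  gcongr
  exact (norm_add_le _ _).trans (by gcongr)

/-- The iterated derivatives in the real direction of `σ ↦ conj σ / |σ|⁴` form a family of smooth
homogeneous functions on `ℍ \ {0}`. -/
theorem exists_smooth_homogeneous_iteratedDeriv (k : ℕ) :
    ∃ G : ℍ[ℝ] → ℍ[ℝ], ContDiffOn ℝ ∞ G {0}ᶜ ∧
      (∀ r : ℝ, 0 < r → ∀ σ : ℍ[ℝ], σ ≠ 0 → G (r • σ) = (r ^ (k + 3))⁻¹ • G σ) ∧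
      ∀ v : ℍ[ℝ], v.re = 0 → ∀ x : ℝ, (x : ℍ[ℝ]) + v ≠ 0 →
        iteratedDeriv k (fun x : ℝ => ((x ^ 2 + ‖v‖ ^ 2) ^ 2)⁻¹ • star ((x : ℍ[ℝ]) + v)) x
          = G (x + v) := by
  induction k with
  | zero =>
    refine ⟨fun σ => ((‖σ‖ ^ 2) ^ 2)⁻¹ • star σ, ?_, ?_, ?_⟩
    · have : StarModule ℝ ℍ[ℝ] :=
        ⟨fun a q => by rw [Quaternion.star_smul, star_trivial a]⟩
      have hstar : ContDiff ℝ ∞ (fun σ : ℍ[ℝ] => star σ) := (starL' ℝ : ℍ[ℝ] ≃L[ℝ] ℍ[ℝ]).contDiff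
      refine ContDiffOn.fun_smul (ContDiffOn.fun_inv ?_ ?_) hstar.contDiffOn
      · exact ((contDiff_norm_sq ℝ).pow 2).contDiffOn
      · intro σ hσ
        have : ‖σ‖ ≠ 0 := norm_ne_zero_iff.2 hσ
        positivity
    · intro r hr σ hσ
      simp only [Quaternion.star_smul, norm_smul, Real.norm_eq_abs, abs_of_pos hr, smul_smul]
      congr 1
      have : ‖σ‖ ≠ 0 := norm_ne_zero_iff.2 hσ
      field_simp
    · intro v hv x hx
      have him : ((x : ℍ[ℝ]) + v).im = v := by ext <;> simp [hv]
      simp only [iteratedDeriv_zero, quaternion_norm_sq ((x : ℍ[ℝ]) + v), him]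
      simp [hv]
  | succ k ih =>
    obtain ⟨G, hG, hhom, hder⟩ := ih
    have hopen : IsOpen ({0}ᶜ : Set ℍ[ℝ]) := isOpen_compl_singleton
    have hdiff : ∀ σ : ℍ[ℝ], σ ≠ 0 → DifferentiableAt ℝ G σ := fun σ hσ =>
      (hG.contDiffAt (hopen.mem_nhds hσ)).differentiableAt (by simp)
    refine ⟨fun σ => fderiv ℝ G σ 1, ?_, ?_, ?_⟩
    · exact (hG.fderiv_of_isOpen hopen (by simp)).clm_apply contDiffOn_const
    · intro r hr σ hσ
      have h1 : (fun τ => G (r • τ)) =ᶠ[nhds σ] fun τ => (r ^ (k + 3))⁻¹ • G τ :=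
        Filter.mem_of_superset (hopen.mem_nhds hσ) fun τ hτ => hhom r hr τ hτ
      have h2 := h1.fderiv_eq (𝕜 := ℝ)
      rw [fderiv_comp_smul, fderiv_fun_const_smul (hdiff σ hσ)] at h2
      have h3 := congrArg (fun L : ℍ[ℝ] →L[ℝ] ℍ[ℝ] => r⁻¹ • L 1) h2
      simp only [smul_apply, smul_smul, inv_mul_cancel₀ hr.ne', one_smul] at h3
      change fderiv ℝ G (r • σ) 1 = (r ^ (k + 1 + 3))⁻¹ • fderiv ℝ G σ 1
      rw [h3, ← mul_inv, ← pow_succ', add_right_comm]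
    · intro v hv x hx
      rw [iteratedDeriv_succ]
      have hcont : Continuous fun z : ℝ => (z : ℍ[ℝ]) + v :=
        Quaternion.continuous_coe.add continuous_const
      have h1 : iteratedDeriv k
          (fun x : ℝ => ((x ^ 2 + ‖v‖ ^ 2) ^ 2)⁻¹ • star ((x : ℍ[ℝ]) + v))
          =ᶠ[nhds x] fun z => G (z + v) :=
        Filter.mem_of_superset (hcont.continuousAt.preimage_mem_nhds (hopen.mem_nhds hx))
          fun z hz => hder v hv z hz
      rw [h1.deriv_eq]
      have h2 : HasDerivAt (fun z : ℝ => (z : ℍ[ℝ]) + v) 1 x := by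
        have := ((hasDerivAt_id x).smul_const (1 : ℍ[ℝ])).add_const v
        simpa only [id, one_smul, ← Quaternion.algebraMap_def, Algebra.algebraMap_eq_smul_one] using this
      exact ((hdiff _ hx).hasFDerivAt.comp_hasDerivAt x h2).deriv

/-- A function that is `C¹` on `E \ {0}` and positively homogeneous of degree `-d` satisfies a
Lipschitz estimate at the scale of its argument. -/
theorem exists_lipschitz_of_homogeneous {E F : Type*} [NormedAddCommGroup E] [NormedSpace ℝ E]
    [ProperSpace E] [NormedAddCommGroup F] [NormedSpace ℝ F] {G : E → F} {d : ℕ}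
    (hG : ContDiffOn ℝ 1 G {0}ᶜ)
    (hhom : ∀ r : ℝ, 0 < r → ∀ x : E, x ≠ 0 → G (r • x) = (r ^ d)⁻¹ • G x) :
    ∃ C : ℝ, 0 < C ∧ ∀ x x₀ : E, x₀ ≠ 0 → ‖x - x₀‖ ≤ ‖x₀‖ / 2 →
      ‖G x - G x₀‖ ≤ C * ‖x - x₀‖ / ‖x₀‖ ^ (d + 1) := by
  have hopen : IsOpen ({0}ᶜ : Set E) := isOpen_compl_singleton
  have hcpt : IsCompact (Metric.closedBall (0 : E) (3 / 2) \ Metric.ball 0 (1 / 2)) :=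
    (isCompact_closedBall _ _).diff Metric.isOpen_ball
  have hsub : Metric.closedBall (0 : E) (3 / 2) \ Metric.ball 0 (1 / 2) ⊆ {0}ᶜ := by
    rintro x ⟨-, hx⟩ rfl
    exact hx (by simp)
  obtain ⟨C, hC⟩ := hcpt.exists_bound_of_continuousOn
    ((hG.continuousOn_fderiv_of_isOpen hopen le_rfl).mono hsub)
  have unit : ∀ x x₀ : E, ‖x₀‖ = 1 → ‖x - x₀‖ ≤ 1 / 2 →
      ‖G x - G x₀‖ ≤ max C 1 * ‖x - x₀‖ := by
    intro x x₀ h0 hx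
    have hmem : Metric.closedBall x₀ (1 / 2) ⊆
        Metric.closedBall (0 : E) (3 / 2) \ Metric.ball 0 (1 / 2) := by
      intro z hz
      rw [mem_closedBall_iff_norm] at hz
      have h1 := norm_sub_norm_le z x₀
      have h2 := norm_sub_norm_le x₀ z
      rw [norm_sub_rev] at h2
      simp only [Set.mem_sdiff, mem_closedBall_zero_iff, mem_ball_zero_iff, not_lt]
      constructor <;> linarith
    refine (convex_closedBall x₀ (1 / 2)).norm_image_sub_le_of_norm_fderiv_le (𝕜 := ℝ)
      (fun z hz => ?_) (fun z hz => (hC z (hmem hz)).trans (le_max_left _ _))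
      (Metric.mem_closedBall_self (by norm_num)) (mem_closedBall_iff_norm.2 hx)
    exact (hG.contDiffAt (hopen.mem_nhds (hsub (hmem hz)))).differentiableAt (by simp)
  refine ⟨max C 1, by positivity, fun x x₀ h0 hx => ?_⟩
  have hr : 0 < ‖x₀‖ := norm_pos_iff.2 h0
  have hx0 : x ≠ 0 := by
    rintro rfl
    rw [zero_sub, norm_neg] at hx
    linarith
  have hscale : ∀ z : E, z ≠ 0 → G z = (‖x₀‖ ^ d)⁻¹ • G (‖x₀‖⁻¹ • z) := fun z hz => by
    rw [← hhom _ hr _ (smul_ne_zero (inv_ne_zero hr.ne') hz), smul_inv_smul₀ hr.ne']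
  have hnorm : ‖‖x₀‖⁻¹ • x - ‖x₀‖⁻¹ • x₀‖ = ‖x - x₀‖ / ‖x₀‖ := by
    rw [← smul_sub, norm_smul, norm_inv, norm_norm, inv_mul_eq_div]
  have h1 := unit (‖x₀‖⁻¹ • x) (‖x₀‖⁻¹ • x₀)
    (by rw [norm_smul, norm_inv, norm_norm, inv_mul_cancel₀ hr.ne'])
    (by rw [hnorm, div_le_iff₀ hr]; linarith)
  rw [hscale x hx0, hscale x₀ h0, ← smul_sub, norm_smul, norm_inv, norm_pow, norm_norm]
  rw [hnorm] at h1
  calc (‖x₀‖ ^ d)⁻¹ * ‖G (‖x₀‖⁻¹ • x) - G (‖x₀‖⁻¹ • x₀)‖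
      ≤ (‖x₀‖ ^ d)⁻¹ * (max C 1 * (‖x - x₀‖ / ‖x₀‖)) := by gcongr
    _ = max C 1 * ‖x - x₀‖ / ‖x₀‖ ^ (d + 1) := by field_simp; ring

theorem sker_lipschitz (n : ℕ) :
    ∃ C : ℝ, 0 < C ∧ ∀ σ σ₀ : ℍ[ℝ], σ₀ ≠ 0 → ‖σ - σ₀‖ ≤ ‖σ₀‖ / 2 →
      ‖sker n σ - sker n σ₀‖ ≤ C * ‖σ - σ₀‖ / ‖σ₀‖ ^ (2 * n - 2 + 3 + 1) := by
  obtain ⟨G, hG, hhom, hder⟩ := exists_smooth_homogeneous_iteratedDeriv (2 * n - 2)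
  have : ProperSpace ℍ[ℝ] := FiniteDimensional.proper ℝ _
  have hs : ∀ σ : ℍ[ℝ], σ ≠ 0 → sker n σ = G σ := fun σ hσ => by
    have := hder σ.im (by simp) σ.re (by simpa using hσ)
    rwa [Quaternion.re_add_im] at this
  obtain ⟨C, hC, h⟩ := exists_lipschitz_of_homogeneous (hG.of_le (by simp)) hhom
  refine ⟨C, hC, fun σ σ₀ h0 hσ => ?_⟩
  have hσ0 : σ ≠ 0 := by
    rintro rfl
    rw [zero_sub, norm_neg] at hσ
    linarith [norm_pos_iff.2 h0]
  rw [hs σ hσ0, hs σ₀ h0]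
  exact h σ σ₀ h0 hσ

/-- Regularity of the Cauchy–Szegő kernel `K(g,h) = K(h⁻¹·g)` in the first
variable: there are constants `C, c > 0` (depending only on `n`) such that
whenever `ρ(g₀,h) ≥ c·ρ(g,g₀)` one has
`|K(g,h) − K(g₀,h)| ≤ C·ρ(g,g₀)/ρ(g₀,h)^{Q+1}` with `Q = 4n+2`. -/
theorem Kker_regularity_first (n : ℕ) (hn : 2 ≤ n) :
    ∃ C : ℝ, 0 < C ∧ ∃ c : ℝ, 0 < c ∧
      ∀ g g₀ h : QH (n - 1), g.1.re = 0 → g₀.1.re = 0 → h.1.re = 0 →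
        h ≠ g → h ≠ g₀ → qdist g₀ h ≥ c * qdist g g₀ →
        ‖Kker n (qmul (qinv h) g) - Kker n (qmul (qinv h) g₀)‖ ≤
          C * qdist g g₀ / qdist g₀ h ^ (4 * n + 2 + 1) := by
  obtain ⟨C, hC, hs⟩ := sker_lipschitz n
  refine ⟨C * 3, by positivity, 6, by norm_num, fun g g₀ h hg hg₀ hh _ _ hρ => ?_⟩
  have hu := qmul_re (qinv_re hg₀) hg
  have hp := qmul_re (qinv_re hh) hg₀
  have hdiff := norm_qpoint_qmul_sub_le hp hu
  have hnp := norm_qpoint hp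
  rw [qmul_qinv_cancel_middle] at hdiff
  change ‖_‖ ≤ qdist g g₀ ^ 2 + 2 * (qdist g₀ h * qdist g g₀) at hdiff
  change _ = qdist g₀ h ^ 2 at hnp
  have ha : 0 ≤ qdist g g₀ := hnorm_nonneg _
  change ‖sker n (qpoint (qmul (qinv h) g)) - sker n (qpoint (qmul (qinv h) g₀))‖ ≤ _
  generalize qdist g g₀ = a at *
  generalize qdist g₀ h = b at *
  generalize qpoint (qmul (qinv h) g) = σ at *
  generalize qpoint (qmul (qinv h) g₀) = σ₀ at *
  have hb : 0 ≤ b := by linarith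
  have hlin : ‖σ - σ₀‖ ≤ 3 * a * b := by nlinarith
  rcases hb.eq_or_lt with rfl | hb
  · have : σ - σ₀ = 0 := norm_le_zero_iff.1 (by simpa using hlin)
    rw [sub_eq_zero.1 this, sub_self, norm_zero]
    positivity
  have h0 : σ₀ ≠ 0 := by
    rw [← norm_pos_iff, hnp]
    positivity
  refine (hs σ σ₀ h0 (by rw [hnp]; nlinarith)).trans ?_
  rw [hnp, ← pow_mul, show 2 * (2 * n - 2 + 3 + 1) = 4 * n + 2 + 1 + 1 by omega]
  calc C * ‖σ - σ₀‖ / b ^ (4 * n + 2 + 1 + 1)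
      ≤ C * (3 * a * b) / b ^ (4 * n + 2 + 1 + 1) := by gcongr
    _ = C * 3 * a / b ^ (4 * n + 2 + 1) := by field_simp; ring
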